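/- Let T > 0, β > 0, C₀ ≥ 0 and K ≥ 0 be real constants with βT^{4/5} ≤ 1 and β(C₀ + K) ≤ 1/2, and let A_≥ : [0,1] → ℝ be twice differentiable with |A_≥'(s)| ≤ KβT and |A_≥''(s)| ≤ KβT^{9/5} for all s ∈ [0,1]. Let 𝒯 be a ternary tree with branching-node set 𝒩 and node signs ζ, let (Ω_𝔫)_{𝔫∈𝒩} be real numbers, and set Ω̃_𝔫(s) := Ω_𝔫(C₀βTs + A_≥(s)). Define 𝒜 recursively by 𝒜_•(s) = 1 for the trivial tree and 𝒜_𝒯(s) = ∫₀^s e^{iζ_𝔯(Ω_𝔯 T s' + Ω̃_𝔯(s'))} ∏_{j=1}^3 𝒜_{𝒯_j}(s') ds', where 𝔯 is the root of 𝒯 and 𝒯₁,𝒯₂,𝒯₃ are its three children subtrees. Then there exists a constant C, depending only on C₀, K and the size of 𝒯, such that for all s ∈ [0,1]: |𝒜_𝒯(s)| ≤ Σ_{(d_𝔫)∈{0,1}^𝒩} ∏_{𝔫∈𝒩} C ⟨T q_𝔫⟩^{−1}, where for each choice of (d_𝔫) the q_𝔫 are defined recursively by q_𝔫 = 0 for leaves,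 and q_𝔫 = d_{𝔫₁}q_{𝔫₁} − d_{𝔫₂}q_{𝔫₂} + d_{𝔫₃}q_{𝔫₃} + Ω_𝔫 when 𝔫 has children 𝔫₁,𝔫₂,𝔫₃. -/

import Mathlib

open MeasureTheory intervalIntegral Complex

/-- A ternary tree: every branching node has exactly three ordered children and carries
its frequency `Ω ∈ ℝ`; leaves carry nothing. -/
inductive TernaryTree where
  | leaf : TernaryTree
  | node : ℝ → TernaryTree → TernaryTree → TernaryTree → TernaryTree

namespace TernaryTree

/-- The scale of a ternary tree: the number of branching nodes. -/
def size : TernaryTree → ℕ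
  | leaf => 0
  | node _ t1 t2 t3 => 1 + t1.size + t2.size + t3.size

/-- The oscillatory multi-integral `𝒜_𝒯(s)` of Corollary 3.2, defined recursively.
The parameter `ζ` is the sign of the root of the (sub)tree: the three children carry
signs `(ζ, -ζ, ζ)`.  The phase of the root node is
`ζ (Ω T s' + Ω̃(s'))` with `Ω̃(s') = Ω (C₀ β T s' + A(s'))`. -/
noncomputable def Acal (T β C0 : ℝ) (A : ℝ → ℝ) : TernaryTree → ℝ → ℝ → ℂ
  | leaf, _, _ => 1
  | node Ω t1 t2 t3, ζ, s =>
      ∫ s' in (0 : ℝ)..s,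
        Complex.exp (Complex.I * ζ * (Ω * (T * s') + Ω * (C0 * β * T * s' + A s')))
          * (Acal T β C0 A t1 ζ s' * Acal T β C0 A t2 (-ζ) s' * Acal T β C0 A t3 ζ s')

/-- For every assignment `(d_𝔫) ∈ {0,1}^𝒩` of the branching nodes of the subtree, one
entry `(d_root * q_root, weight)`, where `q` is defined recursively by `q = 0` at leaves
and `q_𝔫 = d_{𝔫₁} q_{𝔫₁} - d_{𝔫₂} q_{𝔫₂} + d_{𝔫₃} q_{𝔫₃} + Ω_𝔫` at branching nodes,
and the weight is `∏_{𝔫} C ⟨T q_𝔫⟩⁻¹` over the branching nodes of the subtree. -/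
noncomputable def qList (T C : ℝ) : TernaryTree → List (ℝ × ℝ)
  | leaf => (0, 1) :: []
  | node Ω t1 t2 t3 =>
      (qList T C t1).flatMap fun p1 =>
      (qList T C t2).flatMap fun p2 =>
      (qList T C t3).flatMap fun p3 =>
        let q : ℝ := p1.1 - p2.1 + p3.1 + Ω
        let w : ℝ := p1.2 * p2.2 * p3.2 * (C * (Real.sqrt (1 + (T * q) ^ 2))⁻¹)
        (0, w) :: (q, w) :: []

/-- `Σ_{(d_𝔫) ∈ {0,1}^𝒩} ∏_{𝔫 ∈ 𝒩} C ⟨T q_𝔫⟩⁻¹`. -/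
noncomputable def boundSum (T C : ℝ) (t : TernaryTree) : ℝ :=
  ((qList T C t).map Prod.snd).sum

end TernaryTree

namespace TernaryTree

/-- Coefficient functions on `[0,1]`: bounded by `w` together with their derivative. -/
def Good (w : ℝ) (a : ℝ → ℂ) : Prop :=
  ∃ a' : ℝ → ℂ, ∀ s ∈ Set.Icc (0 : ℝ) 1,
    HasDerivWithinAt a (a' s) (Set.Icc (0 : ℝ) 1) s ∧ ‖a s‖ ≤ w ∧ ‖a' s‖ ≤ w

/-- The oscillating factor. -/
noncomputable def Eph (ψ : ℝ → ℝ) (ζ q : ℝ) (s : ℝ) : ℂ :=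
  Complex.exp (Complex.I * ((ζ * q * ψ s : ℝ) : ℂ))

/-- `F` is on `[0,1]` a sum of oscillating factors with good coefficients. -/
def Dec (ψ : ℝ → ℝ) (ζ : ℝ) : List (ℝ × ℝ) → (ℝ → ℂ) → Prop
  | [], F => ∀ s ∈ Set.Icc (0 : ℝ) 1, F s = 0
  | p :: l, F => ∃ (a G : ℝ → ℂ), Good p.2 a ∧ Dec ψ ζ l G ∧
      ∀ s ∈ Set.Icc (0 : ℝ) 1, F s = Eph ψ ζ p.1 s * a s + G s

/-- Hypotheses on the phase. -/
structure Ph (T K : ℝ) (ψ ψ' ψ'' : ℝ → ℝ) : Prop where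
  T0 : 0 < T
  K0 : 0 ≤ K
  d1 : ∀ s ∈ Set.Icc (0 : ℝ) 1, HasDerivWithinAt ψ (ψ' s) (Set.Icc (0 : ℝ) 1) s
  d2 : ∀ s ∈ Set.Icc (0 : ℝ) 1, HasDerivWithinAt ψ' (ψ'' s) (Set.Icc (0 : ℝ) 1) s
  lo : ∀ s ∈ Set.Icc (0 : ℝ) 1, T / 2 ≤ ψ' s
  hi : ∀ s ∈ Set.Icc (0 : ℝ) 1, |ψ'' s| ≤ K * T

theorem Good.nonneg {w a} (h : Good w a) : 0 ≤ w := by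
  obtain ⟨a', h⟩ := h
  exact (norm_nonneg _).trans (h 0 (by simp)).2.1

theorem Good.mono {w v a} (h : Good w a) (hw : w ≤ v) : Good v a := by
  obtain ⟨a', h⟩ := h
  exact ⟨a', fun s hs => ⟨(h s hs).1, (h s hs).2.1.trans hw, (h s hs).2.2.trans hw⟩⟩

theorem Good.cont {w a} (h : Good w a) : ContinuousOn a (Set.Icc (0 : ℝ) 1) := by
  obtain ⟨a', h⟩ := h
  exact fun s hs => (h s hs).1.continuousWithinAt

theorem Good.mul {w v a b} (ha : Good w a) (hb : Good v b) :
    Good (2 * (w * v)) (fun s => a s * b s) := by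
  have hw := ha.nonneg
  have hv := hb.nonneg
  obtain ⟨a', ha⟩ := ha
  obtain ⟨b', hb⟩ := hb
  refine ⟨fun s => a' s * b s + a s * b' s, fun s hs => ?_⟩
  obtain ⟨a1, a2, a3⟩ := ha s hs
  obtain ⟨b1, b2, b3⟩ := hb s hs
  refine ⟨a1.mul b1, ?_, ?_⟩
  · rw [norm_mul]
    have := mul_le_mul a2 b2 (norm_nonneg _) hw
    nlinarith [mul_nonneg hw hv]
  · refine (norm_add_le _ _).trans ?_
    rw [norm_mul, norm_mul]
    have := mul_le_mul a3 b2 (norm_nonneg _) hw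
    have := mul_le_mul a2 b3 (norm_nonneg _) hw
    linarith

theorem good_const {w : ℝ} {c : ℂ} (h : ‖c‖ ≤ w) : Good w (fun _ => c) :=
  ⟨fun _ => 0, fun s _ => ⟨hasDerivWithinAt_const _ _ _, h, by
    simpa using (norm_nonneg c).trans h⟩⟩

theorem norm_Eph (ψ : ℝ → ℝ) (ζ q s : ℝ) : ‖Eph ψ ζ q s‖ = 1 := by
  rw [Eph, mul_comm, Complex.norm_exp_ofReal_mul_I]

theorem Eph_zero (ψ : ℝ → ℝ) (ζ s : ℝ) : Eph ψ ζ 0 s = 1 := by simp [Eph]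

theorem hasDeriv_Eph {T K ψ ψ' ψ''} (h : Ph T K ψ ψ' ψ'') (ζ q : ℝ) {s : ℝ}
    (hs : s ∈ Set.Icc (0 : ℝ) 1) :
    HasDerivWithinAt (Eph ψ ζ q) (Eph ψ ζ q s * (Complex.I * ((ζ * q * ψ' s : ℝ) : ℂ)))
      (Set.Icc (0 : ℝ) 1) s := by
  have h1 := ((h.d1 s hs).const_mul (ζ * q)).ofReal_comp
  exact (h1.const_mul Complex.I).cexp

theorem cont_Eph {T K ψ ψ' ψ''} (h : Ph T K ψ ψ' ψ'') (ζ q : ℝ) :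
    ContinuousOn (Eph ψ ζ q) (Set.Icc (0 : ℝ) 1) :=
  fun _ hs => (hasDeriv_Eph h ζ q hs).continuousWithinAt

theorem Dec.congr {ψ ζ} : ∀ {l F G}, Dec ψ ζ l F →
    (∀ s ∈ Set.Icc (0 : ℝ) 1, F s = G s) → Dec ψ ζ l G
  | [], F, G, h, e => fun s hs => (e s hs).symm.trans (h s hs)
  | _ :: _, F, G, ⟨a, H, h1, h2, h3⟩, e =>
    ⟨a, H, h1, h2, fun s hs => (e s hs).symm.trans (h3 s hs)⟩

theorem Dec.append {ψ ζ} {l' G} (hG : Dec ψ ζ l' G) : ∀ {l F}, Dec ψ ζ l F →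
    Dec ψ ζ (l ++ l') (fun s => F s + G s)
  | [], F, h => hG.congr fun s hs => by simp [h s hs]
  | _ :: _, F, ⟨a, H, h1, h2, h3⟩ =>
    ⟨a, _, h1, Dec.append hG h2, fun s hs => by
      show F s + G s = _
      rw [h3 s hs]; ring⟩

theorem Dec.cont {T K ψ ψ' ψ''} (h : Ph T K ψ ψ' ψ'') {ζ} : ∀ {l F}, Dec ψ ζ l F →
    ContinuousOn F (Set.Icc (0 : ℝ) 1)
  | [], F, h => (continuousOn_const (c := (0 : ℂ))).congr h
  | _ :: _, F, ⟨_, _, h1, h2, h3⟩ =>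
    (((cont_Eph h ζ _).mul h1.cont).add (Dec.cont h h2)).congr h3

theorem Dec.bound {ψ ζ} : ∀ {l F}, Dec ψ ζ l F → ∀ s ∈ Set.Icc (0 : ℝ) 1,
    ‖F s‖ ≤ (l.map Prod.snd).sum
  | [], F, h, s, hs => by simp [h s hs]
  | p :: l, F, ⟨a, G, ⟨a', h1⟩, h2, h3⟩, s, hs => by
    rw [h3 s hs, List.map_cons, List.sum_cons]
    refine (norm_add_le _ _).trans (add_le_add ?_ (Dec.bound h2 s hs))
    rw [norm_mul, norm_Eph, one_mul]
    exact (h1 s hs).2.1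

theorem intble {f : ℝ → ℂ} (hf : ContinuousOn f (Set.Icc (0 : ℝ) 1)) {s : ℝ}
    (hs : s ∈ Set.Icc (0 : ℝ) 1) : IntervalIntegrable f volume 0 s := by
  apply ContinuousOn.intervalIntegrable
  rw [Set.uIcc_of_le hs.1]
  exact hf.mono (Set.Icc_subset_Icc le_rfl hs.2)

theorem int_congr {f g : ℝ → ℂ} (h : ∀ s ∈ Set.Icc (0 : ℝ) 1, f s = g s) {s : ℝ}
    (hs : s ∈ Set.Icc (0 : ℝ) 1) : ∫ u in (0 : ℝ)..s, f u = ∫ u in (0 : ℝ)..s, g u := by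
  apply intervalIntegral.integral_congr
  intro u hu
  rw [Set.uIcc_of_le hs.1] at hu
  exact h u ⟨hu.1, hu.2.trans hs.2⟩

theorem ftc {f : ℝ → ℂ} (hf : ContinuousOn f (Set.Icc (0 : ℝ) 1)) {s : ℝ}
    (hs : s ∈ Set.Icc (0 : ℝ) 1) :
    HasDerivWithinAt (fun x => ∫ u in (0 : ℝ)..x, f u) (f s) (Set.Icc (0 : ℝ) 1) s := by
  have : Fact (s ∈ Set.Icc (0 : ℝ) 1) := ⟨hs⟩
  exact intervalIntegral.integral_hasDerivWithinAt_right (intble hf hs)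
    (hf.stronglyMeasurableAtFilter_nhdsWithin measurableSet_Icc s) (hf s hs)

theorem Dec.int {T K ψ ψ' ψ''} (h : Ph T K ψ ψ' ψ'') {ζ ζ' : ℝ} {g : ℝ → ℂ}
    (hg : ContinuousOn g (Set.Icc (0 : ℝ) 1)) {f : ℝ × ℝ → List (ℝ × ℝ)} :
    ∀ {l F}, Dec ψ ζ l F →
    (∀ p, ∀ a, Good p.2 a →
      Dec ψ ζ' (f p) (fun s => ∫ u in (0 : ℝ)..s, g u * (Eph ψ ζ p.1 u * a u))) →
    Dec ψ ζ' (l.flatMap f) (fun s => ∫ u in (0 : ℝ)..s, g u * F u)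
  | [], F, hF, _ => fun s hs => by
      show ∫ u in (0 : ℝ)..s, g u * F u = 0
      rw [int_congr (g := fun _ => 0) (fun u hu => by simp [hF u hu]) hs]
      simp
  | p :: l, F, ⟨a, G, h1, h2, h3⟩, hp => by
      rw [List.flatMap_cons]
      refine (Dec.append (Dec.int h hg h2 hp) (hp p a h1)).congr fun s hs => ?_
      refine (intervalIntegral.integral_add
        (intble (hg.mul ((cont_Eph h ζ p.1).mul h1.cont)) hs)
        (intble (hg.mul (h2.cont h)) hs)).symm.trans ?_
      refine int_congr (fun u hu => ?_) hs
      show g u * (Eph ψ ζ p.1 u * a u) + g u * G u = g u * F u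
      rw [h3 u hu]
      ring

theorem mvt {w : ℝ} {a a' : ℝ → ℂ}
    (h : ∀ s ∈ Set.Icc (0 : ℝ) 1, HasDerivWithinAt a (a' s) (Set.Icc (0 : ℝ) 1) s)
    (hb : ∀ s ∈ Set.Icc (0 : ℝ) 1, ‖a' s‖ ≤ w) (h0 : ‖a 0‖ ≤ w) :
    Good (2 * w) a := by
  have hw : 0 ≤ w := (norm_nonneg _).trans h0
  refine ⟨a', fun s hs => ⟨h s hs, ?_, (hb s hs).trans (by linarith)⟩⟩
  have := (convex_Icc (0 : ℝ) 1).norm_image_sub_le_of_norm_hasDerivWithin_le h hb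
    (x := 0) (by simp) hs
  have h2 : ‖a s‖ ≤ ‖a s - a 0‖ + ‖a 0‖ := by
    simpa using norm_add_le (a s - a 0) (a 0)
  have h3 : ‖s - 0‖ ≤ 1 := by
    rw [sub_zero, Real.norm_eq_abs, abs_of_nonneg hs.1]; exact hs.2
  nlinarith

theorem good_inv {T K ψ ψ' ψ''} (h : Ph T K ψ ψ' ψ'') {ζ q : ℝ} (hζ : |ζ| = 1)
    (hq : 0 < |q|) :
    Good ((2 + 4 * K) / (T * |q|)) (fun s => (Complex.I * ((ζ * q * ψ' s : ℝ) : ℂ))⁻¹) := by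
  have hT := h.T0
  have hK := h.K0
  have hζ0 : ζ ≠ 0 := by rintro rfl; simp at hζ
  have hq0 : q ≠ 0 := abs_pos.1 hq
  have hn : ∀ x : ℝ, ‖Complex.I * ((ζ * q * x : ℝ) : ℂ)‖ = |q| * |x| := by
    intro x
    rw [norm_mul, Complex.norm_I, Complex.norm_real, Real.norm_eq_abs, abs_mul, abs_mul, hζ]
    ring
  refine ⟨fun s => -(Complex.I * ((ζ * q * ψ'' s : ℝ) : ℂ)) /
    (Complex.I * ((ζ * q * ψ' s : ℝ) : ℂ)) ^ 2, fun s hs => ?_⟩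
  have hlo := h.lo s hs
  have hpos : 0 < ψ' s := by linarith
  have hne : Complex.I * ((ζ * q * ψ' s : ℝ) : ℂ) ≠ 0 :=
    mul_ne_zero Complex.I_ne_zero (by exact_mod_cast mul_ne_zero (mul_ne_zero hζ0 hq0) hpos.ne')
  refine ⟨?_, ?_, ?_⟩
  · have h1 := (((h.d2 s hs).const_mul (ζ * q)).ofReal_comp).const_mul Complex.I
    exact h1.fun_inv hne
  · rw [norm_inv, hn, abs_of_pos hpos, inv_eq_one_div, div_le_div_iff₀ (by positivity) (by positivity)]
    have : 0 ≤ K * (|q| * ψ' s) := by positivity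
    nlinarith
  · rw [norm_div, norm_neg, norm_pow, hn, hn, abs_of_pos hpos,
      div_le_div_iff₀ (by positivity) (by positivity)]
    have h1 := h.hi s hs
    have h2 : T ^ 2 / 4 ≤ ψ' s ^ 2 := by nlinarith
    have h3 : |ψ'' s| * T ≤ 4 * K * ψ' s ^ 2 := by nlinarith
    have h4 : 0 ≤ ψ' s ^ 2 := sq_nonneg _
    calc |q| * |ψ'' s| * (T * |q|) = |q| ^ 2 * (|ψ'' s| * T) := by ring
      _ ≤ |q| ^ 2 * ((2 + 4 * K) * ψ' s ^ 2) :=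
        mul_le_mul_of_nonneg_left (by linarith) (by positivity)
      _ = _ := by ring

theorem bracket_le {x : ℝ} : Real.sqrt (1 + x ^ 2) ≤ 1 + |x| := by
  rw [Real.sqrt_le_left (by positivity)]
  nlinarith [abs_nonneg x, sq_abs x]

theorem entry {T K ψ ψ' ψ''} (h : Ph T K ψ ψ' ψ'') {ζ q W : ℝ} (hζ : |ζ| = 1)
    {b : ℝ → ℂ} (hb : Good (4 * W) b) {w : ℝ}
    (hw : w = W * ((64 + 128 * K) * (Real.sqrt (1 + (T * q) ^ 2))⁻¹)) :
    Dec ψ ζ [(0, w), (q, w)] (fun s => ∫ u in (0 : ℝ)..s, Eph ψ ζ q u * b u) := by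
  have hT := h.T0
  have hK := h.K0
  have hW : 0 ≤ W := by linarith [hb.nonneg]
  have hJ : 0 < Real.sqrt (1 + (T * q) ^ 2) := by positivity
  have hJ2 := bracket_le (x := T * q)
  have hc : ContinuousOn (fun u => Eph ψ ζ q u * b u) (Set.Icc (0 : ℝ) 1) :=
    (cont_Eph h ζ q).mul hb.cont
  have hw0 : 0 ≤ w := by rw [hw]; positivity
  have hTq : |T * q| = T * |q| := by rw [abs_mul, abs_of_pos hT]
  rw [hTq] at hJ2
  by_cases hq : T * |q| ≤ 1
  · refine ⟨fun s => ∫ u in (0 : ℝ)..s, Eph ψ ζ q u * b u, fun _ => 0, ?_, ?_, ?_⟩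
    · have : Good (2 * (4 * W)) (fun s => ∫ u in (0 : ℝ)..s, Eph ψ ζ q u * b u) := by
        refine mvt (fun s hs => ftc hc hs) (fun s hs => ?_) (by simpa using hW)
        rw [norm_mul, norm_Eph, one_mul]
        obtain ⟨b', hb⟩ := hb
        exact (hb s hs).2.1
      refine this.mono ?_
      show _ ≤ w
      rw [hw]
      have : 8 ≤ (64 + 128 * K) * (Real.sqrt (1 + (T * q) ^ 2))⁻¹ := by
        rw [← div_eq_mul_inv, le_div_iff₀ hJ]
        linarith
      nlinarith
    · exact ⟨fun _ => 0, fun _ => 0, good_const (by simpa using hw0), fun _ _ => rfl,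
        fun _ _ => by simp⟩
    · intro s hs
      simp [Eph_zero]
  · push Not at hq
    have hqp : 0 < |q| := by
      by_contra hcon
      have : |q| = 0 := le_antisymm (not_lt.1 hcon) (abs_nonneg q)
      rw [this] at hq
      linarith [mul_zero T]
    have hi := hb.mul (good_inv h hζ hqp)
    set M := 2 * (4 * W * ((2 + 4 * K) / (T * |q|))) with hM
    have hMw : 2 * M ≤ w := by
      rw [hM, hw, ← div_eq_mul_inv]
      have : (16 * (2 + 4 * K)) / (T * |q|) ≤ (64 + 128 * K) / Real.sqrt (1 + (T * q) ^ 2) := by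
        rw [div_le_div_iff₀ (by linarith) hJ]
        have : 0 ≤ K * (2 * (T * |q|) - Real.sqrt (1 + (T * q) ^ 2)) :=
          mul_nonneg hK (by linarith)
        nlinarith
      calc _ = W * ((16 * (2 + 4 * K)) / (T * |q|)) := by ring
        _ ≤ _ := by gcongr
    have hM0 : 0 ≤ M := hi.nonneg
    set c : ℝ → ℂ := fun s => b s * (Complex.I * ((ζ * q * ψ' s : ℝ) : ℂ))⁻¹ with hcdef
    have hζ0 : ζ ≠ 0 := by rintro rfl; simp at hζ
    have hq0 : q ≠ 0 := abs_pos.1 hqp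
    refine ⟨fun s => (∫ u in (0 : ℝ)..s, Eph ψ ζ q u * b u) - Eph ψ ζ q s * c s,
      fun s => Eph ψ ζ q s * c s, ?_, ?_, ?_⟩
    · refine Good.mono ?_ hMw
      obtain ⟨c', hc'⟩ := hi
      refine mvt (a' := fun s => - (Eph ψ ζ q s * c' s)) (fun s hs => ?_) (fun s hs => ?_) ?_
      · have h1 := (ftc hc hs).sub ((hasDeriv_Eph h ζ q hs).mul (hc' s hs).1)
        have hpos : 0 < ψ' s := by linarith [h.lo s hs]
        have hne : Complex.I * ((ζ * q * ψ' s : ℝ) : ℂ) ≠ 0 :=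
          mul_ne_zero Complex.I_ne_zero
            (by exact_mod_cast mul_ne_zero (mul_ne_zero hζ0 hq0) hpos.ne')
        refine h1.congr_deriv ?_
        have : (Complex.I * ((ζ * q * ψ' s : ℝ) : ℂ)) * c s = b s := by
          simp only [hcdef]
          rw [mul_left_comm, mul_inv_cancel₀ hne, mul_one]
        rw [mul_assoc, this]
        ring
      · rw [norm_neg, norm_mul, norm_Eph, one_mul]
        exact (hc' s hs).2.2
      · simp only [intervalIntegral.integral_same, zero_sub]
        rw [norm_neg, norm_mul, norm_Eph, one_mul]
        exact (hc' 0 (by simp)).2.1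
    · exact ⟨c, fun _ => 0, hi.mono (by show M ≤ w; linarith), fun _ _ => rfl,
        fun _ _ => by simp⟩
    · intro s hs
      simp [Eph_zero]

theorem Eph_comb (ψ : ℝ → ℝ) (ζ Ω q1 q2 q3 u : ℝ) :
    Eph ψ ζ Ω u * (Eph ψ ζ q1 u * Eph ψ (-ζ) q2 u * Eph ψ ζ q3 u) =
      Eph ψ ζ (q1 - q2 + q3 + Ω) u := by
  simp only [Eph, ← Complex.exp_add]
  congr 1
  push_cast
  ring

theorem dec_Acal {T β C0 K : ℝ} {A ψ ψ' ψ'' : ℝ → ℝ} (h : Ph T K ψ ψ' ψ'')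
    (hψ : ∀ s, ψ s = T * s + (C0 * β * T * s + A s)) :
    ∀ (t : TernaryTree) (ζ : ℝ), |ζ| = 1 →
      Dec ψ ζ (qList T (64 + 128 * K) t) (Acal T β C0 A t ζ)
  | leaf, ζ, hζ => ⟨fun _ => 1, fun _ => 0, good_const (by simp), fun _ _ => rfl,
      fun s _ => by simp [Eph_zero, Acal]⟩
  | node Ω t1 t2 t3, ζ, hζ => by
    have d1 := dec_Acal h hψ t1 ζ hζ
    have d2 := dec_Acal h hψ t2 (-ζ) (by rwa [abs_neg])
    have d3 := dec_Acal h hψ t3 ζ hζ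
    have k2 := d2.cont h
    have k3 := d3.cont h
    have kE := cont_Eph h ζ Ω
    rw [qList]
    refine Dec.congr (F := fun s => ∫ u in (0 : ℝ)..s,
      (Eph ψ ζ Ω u * (Acal T β C0 A t2 (-ζ) u * Acal T β C0 A t3 ζ u)) *
        Acal T β C0 A t1 ζ u) ?_ ?_
    · refine Dec.int h (kE.mul (k2.mul k3)) d1 fun p1 a1 g1 => ?_
      have ka1 := (cont_Eph h ζ p1.1).mul g1.cont
      refine Dec.congr (F := fun s => ∫ u in (0 : ℝ)..s,
        (Eph ψ ζ Ω u * (Eph ψ ζ p1.1 u * a1 u * Acal T β C0 A t3 ζ u)) *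
          Acal T β C0 A t2 (-ζ) u) ?_ ?_
      · refine Dec.int h (kE.mul (ka1.mul k3)) d2 fun p2 a2 g2 => ?_
        have ka2 := (cont_Eph h (-ζ) p2.1).mul g2.cont
        refine Dec.congr (F := fun s => ∫ u in (0 : ℝ)..s,
          (Eph ψ ζ Ω u * (Eph ψ ζ p1.1 u * a1 u * (Eph ψ (-ζ) p2.1 u * a2 u))) *
            Acal T β C0 A t3 ζ u) ?_ ?_
        · refine Dec.int h (kE.mul (ka1.mul ka2)) d3 fun p3 a3 g3 => ?_
          have g := (g1.mul g2).mul g3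
          refine (entry h hζ (q := p1.1 - p2.1 + p3.1 + Ω) (W := p1.2 * p2.2 * p3.2)
            (g.mono (le_of_eq (by ring))) rfl).congr fun s hs => ?_
          refine int_congr (fun u _ => ?_) hs
          rw [← Eph_comb]
          simp only [Pi.mul_apply]
          ring
        · exact fun s hs => int_congr (fun u _ => by simp only [Pi.mul_apply]; ring) hs
      · exact fun s hs => int_congr (fun u _ => by simp only [Pi.mul_apply]; ring) hs
    · intro s hs
      rw [Acal]
      refine int_congr (fun u _ => ?_) hs
      have : Complex.exp (Complex.I * ζ * (Ω * (T * u) + Ω * (C0 * β * T * u + A u))) =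
          Eph ψ ζ Ω u := by
        rw [Eph, hψ]
        congr 1
        push_cast
        ring
      rw [this]
      ring

end TernaryTree

/-- **Corollary 3.2 (integral estimate, `f ≡ 1`).** There is a constant `C`, depending
only on `C₀`, `K` and the size of the ternary tree, such that the oscillatory
multi-integral `𝒜_𝒯(s)` is bounded by
`Σ_{(d_𝔫) ∈ {0,1}^𝒩} ∏_{𝔫 ∈ 𝒩} C ⟨T q_𝔫⟩⁻¹` for all `s ∈ [0,1]`, provided
`β T^{4/5} ≤ 1`, `β (C₀ + K) ≤ 1/2`, `|A_≥'| ≤ K β T` and `|A_≥''| ≤ K β T^{9/5}`. -/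
theorem integral_estimate_f_one (C0 K : ℝ) (hC0 : 0 ≤ C0) (hK : 0 ≤ K) (n : ℕ) :
    ∃ C : ℝ, 0 < C ∧
      ∀ (T β : ℝ), 0 < T → 0 < β → β * T ^ ((4 : ℝ) / 5) ≤ 1 → β * (C0 + K) ≤ 1 / 2 →
      ∀ (A A' A'' : ℝ → ℝ),
        (∀ s ∈ Set.Icc (0 : ℝ) 1, HasDerivWithinAt A (A' s) (Set.Icc (0 : ℝ) 1) s) →
        (∀ s ∈ Set.Icc (0 : ℝ) 1, HasDerivWithinAt A' (A'' s) (Set.Icc (0 : ℝ) 1) s) →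
        (∀ s ∈ Set.Icc (0 : ℝ) 1, |A' s| ≤ K * β * T) →
        (∀ s ∈ Set.Icc (0 : ℝ) 1, |A'' s| ≤ K * β * T ^ ((9 : ℝ) / 5)) →
      ∀ t : TernaryTree, t.size = n →
      ∀ s ∈ Set.Icc (0 : ℝ) 1,
        ‖TernaryTree.Acal T β C0 A t 1 s‖ ≤ TernaryTree.boundSum T C t := by
  refine ⟨64 + 128 * K, by positivity, ?_⟩
  intro T β hT hβ hβT hβK A A' A'' hA hA' bA bA'' t _ s hs
  have hph : TernaryTree.Ph T K (fun s => T * s + (C0 * β * T * s + A s))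
      (fun s => T + (C0 * β * T + A' s)) A'' := by
    refine ⟨hT, hK, fun s hs => ?_, fun s hs => ?_, fun s hs => ?_, fun s hs => ?_⟩
    · have h1 := (hasDerivWithinAt_id s (Set.Icc (0 : ℝ) 1)).const_mul T
      have h2 := (hasDerivWithinAt_id s (Set.Icc (0 : ℝ) 1)).const_mul (C0 * β * T)
      have h3 := h1.add (h2.add (hA s hs))
      refine h3.congr_deriv ?_
      ring
    · exact ((hA' s hs).const_add (C0 * β * T)).const_add T
    · have h1 := neg_le_of_abs_le (bA s hs)
      have h2 : K * β ≤ 1 / 2 := by nlinarith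
      have h3 : K * β * T ≤ 1 / 2 * T := by gcongr
      have h4 : 0 ≤ C0 * β * T := by positivity
      show T / 2 ≤ T + (C0 * β * T + A' s)
      linarith
    · refine (bA'' s hs).trans ?_
      have : T ^ ((9 : ℝ) / 5) = T ^ ((4 : ℝ) / 5) * T := by
        rw [show (9 : ℝ) / 5 = 4 / 5 + 1 by norm_num, Real.rpow_add hT, Real.rpow_one]
      rw [this]
      calc K * β * (T ^ ((4 : ℝ) / 5) * T) = K * (β * T ^ ((4 : ℝ) / 5)) * T := by ring
        _ ≤ K * 1 * T := by gcongr
        _ = K * T := by ring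
  exact (TernaryTree.dec_Acal hph (fun _ => rfl) t 1 (by simp)).bound s hs
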